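/- arXiv:1503.08456 — 3 statements merged into one kernel-verified Lean document; each statement's English description precedes it below -/
import Mathlib

section
/- Let T be a tensor triangulated category which is closed symmetric monoidal, with internal hom F(−,−) and unit S, and in which every object is dualizable. Let I₀ and J₀ be collections of objects of T, and let I and J be the thick ideals they generate. Then I ∩ J = thickid({Y ⊗ Z : Y ∈ I₀, Z ∈ J₀}), the thick ideal generated by the tensor products of the generators. -/
/-!
STATEMENT 4: In a closed symmetric tensor triangulated category in which every object
is dualizable, the intersection of the thick ideals generated by two families of
objects is the thick ideal generated by the tensor products of the generators.
-/

open CategoryTheory CategoryTheory.Limits CategoryTheory.Pretriangulated MonoidalCategory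

universe v u

/-- A thick subcategory of a pretriangulated category, encoded as a set of objects
which is nonempty, closed under isomorphisms, shifts, extensions (two-out-of-three
for distinguished triangles) and retracts. -/
structure ThickSubcategory (C : Type u) [Category.{v} C] [HasZeroObject C] [HasShift C ℤ]
    [Preadditive C] [∀ n : ℤ, (CategoryTheory.shiftFunctor C n).Additive]
    [Pretriangulated C] where
  set : Set C
  nonempty : set.Nonempty
  iso_closed : ∀ ⦃X Y : C⦄, (X ≅ Y) → X ∈ set → Y ∈ set
  shift_closed : ∀ (X : C) (n : ℤ), X ∈ set → (X⟦n⟧ : C) ∈ set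
  ext₃ : ∀ (T : Triangle C), (T ∈ distTriang C) → T.obj₁ ∈ set → T.obj₂ ∈ set → T.obj₃ ∈ set
  retract_closed : ∀ ⦃X Y : C⦄ (i : X ⟶ Y) (r : Y ⟶ X), i ≫ r = 𝟙 X → Y ∈ set → X ∈ set

variable (C : Type u) [Category.{v} C] [HasZeroObject C] [HasShift C ℤ]
  [Preadditive C] [∀ n : ℤ, (CategoryTheory.shiftFunctor C n).Additive] [Pretriangulated C]
  [MonoidalCategory C] [SymmetricCategory C]

/-- The compatibility of the (symmetric) monoidal structure with the triangulation:
tensoring with any object sends distinguished triangles to distinguished triangles. -/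
def TensorTriangulated : Prop :=
  ∀ (A : C) (T : Triangle C), (T ∈ distTriang C) →
    ∃ e : A ⊗ (T.obj₁⟦(1 : ℤ)⟧) ≅ (A ⊗ T.obj₁)⟦(1 : ℤ)⟧,
      Triangle.mk (A ◁ T.mor₁) (A ◁ T.mor₂) ((A ◁ T.mor₃) ≫ e.hom) ∈ distTriang C

variable {C}

/-- A thick subcategory is a thick ideal if it absorbs tensoring by arbitrary objects. -/
def IsThickIdeal (S : ThickSubcategory C) : Prop :=
  ∀ (X : C) ⦃Y : C⦄, Y ∈ S.set → X ⊗ Y ∈ S.set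

variable (C)

/-- The smallest thick ideal containing a given class of objects. -/
def thickIdealGen (A : Set C) : Set C :=
  {X : C | ∀ S : ThickSubcategory C, IsThickIdeal S → A ⊆ S.set → X ∈ S.set}

variable [MonoidalClosed C]

variable {C}

/-- The canonical map `F(X, S) ⊗ Y ⟶ F(X, Y)`, where `F(−,−)` is the internal hom and
`S` is the unit; `X` is dualizable precisely when this map is an isomorphism for all
`Y`. -/
noncomputable def dualPairing (X Y : C) : ((ihom X).obj (𝟙_ C)) ⊗ Y ⟶ (ihom X).obj Y :=
  MonoidalClosed.curry
    ((α_ X ((ihom X).obj (𝟙_ C)) Y).inv ≫ ((ihom.ev X).app (𝟙_ C) ▷ Y) ≫ (λ_ Y).hom)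

theorem aux_tensor_shift_one (htt : TensorTriangulated C) (A X : C) :
    Nonempty (A ⊗ (X⟦(1 : ℤ)⟧) ≅ (A ⊗ X)⟦(1 : ℤ)⟧) :=
  ⟨(htt A (contractibleTriangle X) (contractible_distinguished X)).choose⟩

theorem aux_tensor_shift_neg_one (htt : TensorTriangulated C) (A X : C) :
    Nonempty (A ⊗ (X⟦(-1 : ℤ)⟧) ≅ (A ⊗ X)⟦(-1 : ℤ)⟧) := by
  obtain ⟨e⟩ := aux_tensor_shift_one htt A (X⟦(-1 : ℤ)⟧)
  exact ⟨((shiftEquiv C (1 : ℤ)).unitIso.app (A ⊗ (X⟦(-1 : ℤ)⟧))) ≪≫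
    (shiftFunctor C (-1 : ℤ)).mapIso
      (e.symm ≪≫ whiskerLeftIso A ((shiftEquiv C (1 : ℤ)).counitIso.app X))⟩

theorem aux_tensor_shift (htt : TensorTriangulated C) (A X : C) (n : ℤ) :
    Nonempty (A ⊗ (X⟦n⟧) ≅ (A ⊗ X)⟦n⟧) := by
  induction n using Int.induction_on with
  | zero =>
    exact ⟨whiskerLeftIso A ((shiftFunctorZero C ℤ).app X) ≪≫
      ((shiftFunctorZero C ℤ).app (A ⊗ X)).symm⟩
  | succ i ih =>
    obtain ⟨e⟩ := ih
    obtain ⟨f⟩ := aux_tensor_shift_one htt A (X⟦(i : ℤ)⟧)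
    exact ⟨whiskerLeftIso A ((shiftFunctorAdd C (i : ℤ) 1).app X) ≪≫ f ≪≫
      (shiftFunctor C (1 : ℤ)).mapIso e ≪≫ ((shiftFunctorAdd C (i : ℤ) 1).app (A ⊗ X)).symm⟩
  | pred i ih =>
    obtain ⟨e⟩ := ih
    obtain ⟨f⟩ := aux_tensor_shift_neg_one htt A (X⟦(-i : ℤ)⟧)
    exact ⟨whiskerLeftIso A ((shiftFunctorAdd C (-i : ℤ) (-1)).app X) ≪≫ f ≪≫
      (shiftFunctor C (-1 : ℤ)).mapIso e ≪≫
        ((shiftFunctorAdd C (-i : ℤ) (-1)).app (A ⊗ X)).symm⟩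

/-- The colon ideal of `S` by the object `A`. -/
def auxColon (htt : TensorTriangulated C) (S : ThickSubcategory C) (hS : IsThickIdeal S)
    (A : C) : ThickSubcategory C where
  set := {X | A ⊗ X ∈ S.set}
  nonempty := S.nonempty.imp fun _ hX => hS A hX
  iso_closed _ _ e h := S.iso_closed (whiskerLeftIso A e) h
  shift_closed X n h := by
    obtain ⟨e⟩ := aux_tensor_shift htt A X n
    exact S.iso_closed e.symm (S.shift_closed _ n h)
  ext₃ T hT h₁ h₂ := by
    obtain ⟨e, he⟩ := htt A T hT
    exact S.ext₃ _ he h₁ h₂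
  retract_closed X Y i r h hY := S.retract_closed (A ◁ i) (A ◁ r)
    (by rw [← MonoidalCategory.whiskerLeft_comp, h, MonoidalCategory.whiskerLeft_id]) hY

/-- The isomorphism `A ⊗ (B ⊗ D) ≅ B ⊗ (A ⊗ D)`. -/
def auxSwap (A B D : C) : A ⊗ (B ⊗ D) ≅ B ⊗ (A ⊗ D) :=
  (α_ A B D).symm ≪≫ whiskerRightIso (β_ A B) D ≪≫ α_ B A D

theorem auxColon_ideal (htt : TensorTriangulated C) (S : ThickSubcategory C)
    (hS : IsThickIdeal S) (A : C) : IsThickIdeal (auxColon htt S hS A) := fun X Y hY =>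
  S.iso_closed (auxSwap X A Y) (hS X hY)

theorem aux_square (hdual : ∀ X Y : C, IsIso (dualPairing X Y)) (S : ThickSubcategory C)
    (hS : IsThickIdeal S) (X : C) (h : X ⊗ X ∈ S.set) : X ∈ S.set := by
  have h1 : X ⊗ (ihom X).obj X ∈ S.set := by
    haveI := hdual X X
    exact S.iso_closed (auxSwap ((ihom X).obj (𝟙_ C)) X X ≪≫
      whiskerLeftIso X (asIso (dualPairing X X))) (hS _ h)
  refine S.retract_closed ((ρ_ X).inv ≫ X ◁ MonoidalClosed.curry (ρ_ X).hom)
    ((ihom.ev X).app X) ?_ h1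
  rw [Category.assoc, ← MonoidalClosed.uncurry_eq, MonoidalClosed.uncurry_curry,
    Iso.inv_hom_id]

/-- Let `C` be a closed symmetric tensor triangulated category in which every object is
dualizable.  For classes of objects `I₀`, `J₀` generating thick ideals `I`, `J`, the
intersection `I ∩ J` is the thick ideal generated by `{Y ⊗ Z : Y ∈ I₀, Z ∈ J₀}`. -/
theorem stmt_4 (htt : TensorTriangulated C)
    (hdual : ∀ X Y : C, IsIso (dualPairing X Y))
    (I₀ J₀ : Set C) :
    thickIdealGen C I₀ ∩ thickIdealGen C J₀ =
      thickIdealGen C (Set.image2 (fun Y Z : C => Y ⊗ Z) I₀ J₀) := by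
  apply Set.Subset.antisymm
  · rintro X ⟨hI, hJ⟩ S hS hsub
    refine aux_square hdual S hS X ?_
    refine hI (auxColon htt S hS X) (auxColon_ideal htt S hS X) fun Y hY => ?_
    refine S.iso_closed (β_ Y X) ?_
    exact hJ (auxColon htt S hS Y) (auxColon_ideal htt S hS Y) fun Z hZ =>
      hsub ⟨Y, hY, Z, hZ, rfl⟩
  · intro X hX
    constructor
    · intro S hS hsub
      refine hX S hS ?_
      rintro _ ⟨Y, hY, Z, hZ, rfl⟩
      exact S.iso_closed (β_ Z Y) (hS Z (hsub hY))
    · intro S hS hsub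
      refine hX S hS ?_
      rintro _ ⟨Y, hY, Z, hZ, rfl⟩
      exact hS Y (hsub hZ)
end

section
/- Let T be a tensor triangulated category which is closed symmetric monoidal, with internal hom F(−,−) and unit S, and in which every object is dualizable. For an object X, let ann(X) denote the fibre of the unit map u : S → F(X,X), i.e. an object fitting in a distinguished triangle ann(X) → S → F(X,X), and for n > 0 let ann(X)^{⊗n} ⊗ A → A denote the n-fold tensor power of the map ann(X) → S tensored with the identity of A. Then: (1) the thick ideal generated by X equals A_{ann(X)} = {A ∈ T : the map ann(X)^{⊗n} ⊗ A → A is zero for some n > 0}; and (2) thickid(X) ⊆ thickid(Y) if and only if the map ann(Y)^{⊗n} → S factors through ann(X) → S for some n > 0. -/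
/-!
STATEMENT 5: In a closed symmetric tensor triangulated category in which every object
is dualizable: (1) the thick ideal generated by `X` equals
`{A : ann(X)^{⊗n} ⊗ A → A is zero for some n > 0}`, where `ann(X)` is the fibre of the
unit map `S → F(X,X)`; (2) `thickid X ⊆ thickid Y` iff `ann(Y)^{⊗n} → S` factors
through `ann(X) → S` for some `n > 0`.
-/

open CategoryTheory CategoryTheory.Limits CategoryTheory.Pretriangulated MonoidalCategory

universe v u

variable (C : Type u) [Category.{v} C] [HasZeroObject C] [HasShift C ℤ]
  [Preadditive C] [∀ n : ℤ, (CategoryTheory.shiftFunctor C n).Additive] [Pretriangulated C]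
  [MonoidalCategory C] [SymmetricCategory C]

variable {C}

variable (C)

variable {C}

/-- The `n`-fold tensor power of an object. -/
def npow (A : C) : ℕ → C
  | 0 => 𝟙_ C
  | n + 1 => A ⊗ npow A n

/-- The `n`-fold tensor power of a morphism `a : A ⟶ 𝟙_ C`, viewed as a morphism
`A^{⊗n} ⟶ 𝟙_ C`. -/
def npowMap {A : C} (a : A ⟶ 𝟙_ C) : (n : ℕ) → (npow A n ⟶ 𝟙_ C)
  | 0 => 𝟙 (𝟙_ C)
  | n + 1 => (MonoidalCategory.tensorHom a (npowMap a n)) ≫ (λ_ (𝟙_ C)).hom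

variable [MonoidalClosed C]

/-- The unit map `S ⟶ F(X, X)` of the internal hom, adjoint to the right unitor. -/
noncomputable def unitMap (X : C) : 𝟙_ C ⟶ (ihom X).obj X :=
  MonoidalClosed.curry (ρ_ X).hom

set_option linter.unusedSectionVars false

namespace Stmt5Aux

/-- `f` has a cone in the thick subcategory `S`. -/
def HasConeIn (S : ThickSubcategory C) {P Q : C} (f : P ⟶ Q) : Prop :=
  ∃ (F : C) (u : Q ⟶ F) (δ : F ⟶ P⟦(1 : ℤ)⟧), Triangle.mk f u δ ∈ distTriang C ∧ F ∈ S.set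

lemma ext2 (S : ThickSubcategory C) (T : Triangle C) (hT : T ∈ distTriang C)
    (h1 : T.obj₁ ∈ S.set) (h3 : T.obj₃ ∈ S.set) : T.obj₂ ∈ S.set :=
  S.ext₃ T.invRotate (inv_rot_of_distTriang _ hT) (S.shift_closed _ _ h3) h1

lemma factor2 {P Q F W : C} {f : P ⟶ Q} {u : Q ⟶ F} {δ : F ⟶ P⟦(1 : ℤ)⟧}
    (h : Triangle.mk f u δ ∈ distTriang C) (x : W ⟶ Q) (hx : x ≫ u = 0) :
    ∃ t : W ⟶ P, x = t ≫ f := Triangle.coyoneda_exact₂ _ h x hx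

lemma cofactor2 {P Q F W : C} {f : P ⟶ Q} {u : Q ⟶ F} {δ : F ⟶ P⟦(1 : ℤ)⟧}
    (h : Triangle.mk f u δ ∈ distTriang C) (x : Q ⟶ W) (hx : f ≫ x = 0) :
    ∃ t : F ⟶ W, x = u ≫ t := Triangle.yoneda_exact₂ _ h x hx

lemma cofactor3 {P Q F W : C} {f : P ⟶ Q} {u : Q ⟶ F} {δ : F ⟶ P⟦(1 : ℤ)⟧}
    (h : Triangle.mk f u δ ∈ distTriang C) (x : F ⟶ W) (hx : u ≫ x = 0) :
    ∃ t : P⟦(1 : ℤ)⟧ ⟶ W, x = δ ≫ t := Triangle.yoneda_exact₃ _ h x hx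

/-- The connecting map `G⟦-1⟧ ⟶ Q` (up to sign) of a map `G ⟶ Q⟦1⟧`. -/
noncomputable def desusp {G Q : C} (δ : G ⟶ Q⟦(1 : ℤ)⟧) : G⟦(-1 : ℤ)⟧ ⟶ Q :=
  -δ⟦(-1 : ℤ)⟧' ≫ (shiftFunctorCompIsoId C (1 : ℤ) (-1) (by simp)).hom.app Q

lemma desusp_comp {G Q F : C} (δ : G ⟶ Q⟦(1 : ℤ)⟧) (u : Q ⟶ F) :
    desusp (δ ≫ u⟦(1 : ℤ)⟧') = desusp δ ≫ u := by
  have h := (shiftFunctorCompIsoId C (1 : ℤ) (-1) (by simp)).hom.naturality u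
  simp only [Functor.comp_map, Functor.id_map] at h
  simp only [desusp, Functor.map_comp, Preadditive.neg_comp, Category.assoc, h]

lemma inv_rot {P Q F : C} {f : P ⟶ Q} {u : Q ⟶ F} {δ : F ⟶ P⟦(1 : ℤ)⟧}
    (h : Triangle.mk f u δ ∈ distTriang C) :
    ∃ w, Triangle.mk (desusp δ) f w ∈ distTriang C :=
  ⟨_, inv_rot_of_distTriang _ h⟩

/-- Approximation of a composite, which replaces the octahedral axiom. -/
lemma comp_approx (S : ThickSubcategory C) {P Q Z : C} (f : P ⟶ Q) (g : Q ⟶ Z)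
    (hf : HasConeIn S f) (hg : HasConeIn S g) :
    ∃ (P' : C) (g' : P' ⟶ Z) (t : P' ⟶ P), g' = t ≫ f ≫ g ∧ HasConeIn S g' := by
  obtain ⟨F, uf, δf, hTf, hF⟩ := hf
  obtain ⟨G, ug, δg, hTg, hG⟩ := hg
  obtain ⟨E, j, k, hE⟩ := distinguished_cocone_triangle₂ (δg ≫ uf⟦(1 : ℤ)⟧')
  obtain ⟨v, hv1, hv2⟩ : ∃ v : Z ⟶ E, g ≫ v = uf ≫ j ∧ ug = v ≫ k := by
    obtain ⟨v, hv1, hv2⟩ := complete_distinguished_triangle_morphism₂ _ _ hTg hE uf (𝟙 G)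
      (Category.id_comp _).symm
    exact ⟨v, hv1, (Category.comp_id ug).symm.trans hv2⟩
  have hES : E ∈ S.set := ext2 S _ hE hF hG
  obtain ⟨P', g', w, hT'⟩ := distinguished_cocone_triangle₁ v
  have hgv : g' ≫ v = 0 := comp_distTriang_mor_zero₁₂ _ hT'
  have hgu : g' ≫ ug = 0 := by
    rw [hv2, ← Category.assoc, hgv, zero_comp]
  obtain ⟨t, ht⟩ := factor2 hTg g' hgu
  have htj : (t ≫ uf) ≫ j = 0 := by
    rw [Category.assoc, ← hv1, ← Category.assoc, ← ht, hgv]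
  obtain ⟨w1, hw1⟩ := inv_rot hE
  obtain ⟨w2, hw2⟩ := inv_rot hTg
  obtain ⟨s, hs⟩ := factor2 hw1 (t ≫ uf) htj
  have hz : desusp δg ≫ g = 0 := comp_distTriang_mor_zero₁₂ _ hw2
  rw [desusp_comp] at hs
  obtain ⟨r, hr⟩ := factor2 hTf (t - s ≫ desusp δg) (by
    rw [Preadditive.sub_comp, hs, Category.assoc, sub_self])
  refine ⟨P', g', r, ?_, E, v, w, hT', hES⟩
  rw [← Category.assoc, ← hr, Preadditive.sub_comp, Category.assoc, hz, comp_zero, sub_zero]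
  exact ht

lemma whiskerLeft_zero' (A P Q : C) : A ◁ (0 : P ⟶ Q) = 0 := by
  have : (tensorLeft A).IsLeftAdjoint := ⟨_, ⟨ihom.adjunction A⟩⟩
  exact (tensorLeft A).map_zero P Q

lemma zero_whiskerRight' (A P Q : C) : (0 : P ⟶ Q) ▷ A = 0 := by
  have h := BraidedCategory.braiding_naturality_left (0 : P ⟶ Q) A
  rw [whiskerLeft_zero', comp_zero] at h
  exact (cancel_mono (β_ Q A).hom).1 (by rw [h, zero_comp])

lemma left_of_right {P Q : C} {p : P ⟶ Q} {B : C} (h : p ▷ B = 0) : B ◁ p = 0 := by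
  have h' := BraidedCategory.braiding_naturality_left p B
  rw [h, zero_comp] at h'
  exact (cancel_epi (β_ P B).hom).1 (by rw [← h', comp_zero])

lemma right_of_left {P Q : C} {p : P ⟶ Q} {B : C} (h : B ◁ p = 0) : p ▷ B = 0 := by
  have h' := BraidedCategory.braiding_naturality_left p B
  rw [h, comp_zero] at h'
  exact (cancel_mono (β_ Q B).hom).1 (by rw [h', zero_comp])

lemma kills_retract {P Q : C} {p : P ⟶ Q} {X Y : C} (i : X ⟶ Y) (r : Y ⟶ X)
    (hir : i ≫ r = 𝟙 X) (h : p ▷ Y = 0) : p ▷ X = 0 := by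
  have : p ▷ X = P ◁ i ≫ p ▷ Y ≫ Q ◁ r := by
    rw [← whisker_exchange, ← MonoidalCategory.whiskerLeft_comp_assoc, hir]; simp
  rw [this, h, zero_comp, comp_zero]

lemma kills_iso {P Q : C} {p : P ⟶ Q} {X Y : C} (e : X ≅ Y)
    (h : p ▷ X = 0) : p ▷ Y = 0 := kills_retract e.inv e.hom e.inv_hom_id h

lemma kills_tensor {P Q : C} {p : P ⟶ Q} {B : C} (W : C) (h : p ▷ B = 0) :
    p ▷ (W ⊗ B) = 0 := by
  refine kills_iso (β_ B W) ?_
  rw [MonoidalCategory.whiskerRight_tensor, h, zero_whiskerRight', zero_comp, comp_zero]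

lemma shiftIso (htt : TensorTriangulated C) (A B : C) :
    Nonempty (A ⊗ (B⟦(1 : ℤ)⟧) ≅ (A ⊗ B)⟦(1 : ℤ)⟧) := by
  obtain ⟨e, -⟩ := htt A _ (contractible_distinguished B)
  exact ⟨e⟩

lemma kills_shift_one (htt : TensorTriangulated C) {P Q : C} {p : P ⟶ Q} {B : C}
    (h : p ▷ B = 0) : p ▷ (B⟦(1 : ℤ)⟧) = 0 := by
  obtain ⟨e⟩ := shiftIso htt B (𝟙_ C)
  exact kills_iso (β_ _ _ ≪≫ e ≪≫ (shiftFunctor C (1 : ℤ)).mapIso (ρ_ B)) (kills_tensor _ h)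

lemma kills_shift_neg_one (htt : TensorTriangulated C) {P Q : C} {p : P ⟶ Q} {B : C}
    (h : p ▷ B = 0) : p ▷ (B⟦(-1 : ℤ)⟧) = 0 := by
  obtain ⟨e⟩ := shiftIso htt B ((𝟙_ C)⟦(-1 : ℤ)⟧)
  have e1 : ((𝟙_ C)⟦(-1 : ℤ)⟧)⟦(1 : ℤ)⟧ ≅ 𝟙_ C :=
    (shiftFunctorCompIsoId C (-1 : ℤ) 1 (by simp)).app _
  have e2 : ((B ⊗ ((𝟙_ C)⟦(-1 : ℤ)⟧))⟦(1 : ℤ)⟧)⟦(-1 : ℤ)⟧ ≅ B ⊗ ((𝟙_ C)⟦(-1 : ℤ)⟧) :=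
    (shiftFunctorCompIsoId C (1 : ℤ) (-1) (by simp)).app _
  have e3 : (B ⊗ ((𝟙_ C)⟦(-1 : ℤ)⟧))⟦(1 : ℤ)⟧ ≅ B :=
    e.symm ≪≫ whiskerLeftIso B e1 ≪≫ ρ_ B
  exact kills_iso (β_ _ _ ≪≫ e2.symm ≪≫ (shiftFunctor C (-1 : ℤ)).mapIso e3) (kills_tensor _ h)

lemma kills_shift (htt : TensorTriangulated C) {P Q : C} {p : P ⟶ Q} {B : C}
    (h : p ▷ B = 0) (n : ℤ) : p ▷ (B⟦n⟧) = 0 := by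
  induction n using Int.induction_on with
  | zero => exact kills_iso ((shiftFunctorZero C ℤ).symm.app B) h
  | succ i ih =>
    exact kills_iso ((shiftFunctorAdd' C (i : ℤ) 1 _ rfl).symm.app B) (kills_shift_one htt ih)
  | pred i ih =>
    exact kills_iso ((shiftFunctorAdd' C (-i : ℤ) (-1) _ rfl).symm.app B)
      (kills_shift_neg_one htt ih)

lemma kills_ext3 (htt : TensorTriangulated C) {P Q : C} (p : P ⟶ 𝟙_ C) (q : Q ⟶ 𝟙_ C)
    (T : Triangle C) (hT : T ∈ distTriang C) (h1 : q ▷ T.obj₁ = 0) (h2 : p ▷ T.obj₂ = 0) :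
    ((q ⊗ₘ p) ≫ (λ_ (𝟙_ C)).hom) ▷ T.obj₃ = 0 := by
  obtain ⟨e, he⟩ := htt P T hT
  have hθ : P ◁ T.mor₂ ≫ (p ▷ T.obj₃ ≫ (λ_ _).hom) = 0 := by
    rw [whisker_exchange_assoc, h2, zero_comp]
  obtain ⟨r, hr⟩ := cofactor3 he _ hθ
  rw [Category.assoc] at hr
  have hk : q ▷ (P ⊗ T.obj₁⟦(1 : ℤ)⟧) = 0 := kills_tensor _ (kills_shift htt h1 1)
  have key : Q ◁ (p ▷ T.obj₃ ≫ (λ_ _).hom) ≫ q ▷ T.obj₃ = 0 := by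
    rw [hr, whisker_exchange, MonoidalCategory.whiskerLeft_comp,
      ← whisker_exchange_assoc, MonoidalCategory.whiskerLeft_comp, hk, zero_comp, comp_zero]
  have : ((q ⊗ₘ p) ≫ (λ_ (𝟙_ C)).hom) ▷ T.obj₃ =
      (α_ _ _ _).hom ≫ Q ◁ (p ▷ T.obj₃ ≫ (λ_ _).hom) ≫ q ▷ T.obj₃ := by
    rw [MonoidalCategory.tensorHom_def']
    monoidal
  rw [this, key, comp_zero]

lemma npow_add {A : C} (a : A ⟶ 𝟙_ C) (m n : ℕ) :
    ∃ e : npow A (m + n) ⟶ npow A n ⊗ npow A m,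
      npowMap a (m + n) = e ≫ (npowMap a n ⊗ₘ npowMap a m) ≫ (λ_ (𝟙_ C)).hom := by
  induction n with
  | zero =>
    refine ⟨(λ_ (npow A m)).inv, ?_⟩
    simp [npowMap, npow]
  | succ n ih =>
    obtain ⟨e, he⟩ := ih
    refine ⟨A ◁ e ≫ (α_ A (npow A n) (npow A m)).inv, ?_⟩
    change (a ⊗ₘ npowMap a (m + n)) ≫ (λ_ (𝟙_ C)).hom =
      (A ◁ e ≫ (α_ A (npow A n) (npow A m)).inv) ≫
        (((a ⊗ₘ npowMap a n) ≫ (λ_ (𝟙_ C)).hom) ⊗ₘ npowMap a m) ≫ (λ_ (𝟙_ C)).hom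
    have h1 : ∀ y : npow A n ⊗ npow A m ⟶ 𝟙_ C, a ⊗ₘ (e ≫ y) = A ◁ e ≫ (a ⊗ₘ y) := by
      intro y
      rw [MonoidalCategory.tensorHom_def', MonoidalCategory.tensorHom_def',
        MonoidalCategory.whiskerLeft_comp, Category.assoc]
    rw [he, h1]
    simp only [MonoidalCategory.tensorHom_def]
    monoidal

lemma kills_unit {X AX : C} (aX : AX ⟶ 𝟙_ C) (h : aX ≫ unitMap X = 0) : aX ▷ X = 0 := by
  apply right_of_left
  have h1 : X ◁ unitMap X ≫ (ihom.ev X).app X = (ρ_ X).hom := by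
    rw [← MonoidalClosed.uncurry_eq, unitMap, MonoidalClosed.uncurry_curry]
  rw [← cancel_mono (ρ_ X).hom, ← h1, ← MonoidalCategory.whiskerLeft_comp_assoc, h,
    whiskerLeft_zero', zero_comp, zero_comp]

lemma comp_unitMap {X P : C} (p : P ⟶ 𝟙_ C) (h : p ▷ X = 0) : p ≫ unitMap X = 0 := by
  have : p ≫ unitMap X = MonoidalClosed.curry (X ◁ p ≫ (ρ_ X).hom) := by
    rw [MonoidalClosed.curry_natural_left]; rfl
  rw [this, left_of_right h, zero_comp]
  apply MonoidalClosed.uncurry_injective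
  rw [MonoidalClosed.uncurry_curry, MonoidalClosed.uncurry_eq, whiskerLeft_zero', zero_comp]

/-- The thick subcategory of objects killed by a power of `a`. -/
def annThick (htt : TensorTriangulated C) {A : C} (a : A ⟶ 𝟙_ C) : ThickSubcategory C where
  set := {B : C | ∃ n : ℕ, 0 < n ∧ npowMap a n ▷ B = 0}
  nonempty := by
    obtain ⟨Z, hZ⟩ := HasZeroObject.zero (C := C)
    refine ⟨Z, 1, one_pos, ?_⟩
    rw [← Category.comp_id (npowMap a 1 ▷ Z), ← MonoidalCategory.whiskerLeft_id,
      hZ.eq_of_src (𝟙 Z) 0, whiskerLeft_zero', comp_zero]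
  iso_closed := fun X Y e ⟨n, hn, h⟩ => ⟨n, hn, kills_iso e h⟩
  shift_closed := fun X k ⟨n, hn, h⟩ => ⟨n, hn, kills_shift htt h k⟩
  ext₃ := by
    rintro T hT ⟨n, hn, h⟩ ⟨m, hm, h'⟩
    refine ⟨m + n, by omega, ?_⟩
    obtain ⟨e, he⟩ := npow_add a m n
    rw [he, comp_whiskerRight, kills_ext3 htt _ _ T hT h h', comp_zero]
  retract_closed := fun X Y i r hir ⟨n, hn, h⟩ => ⟨n, hn, kills_retract i r hir h⟩

lemma mem_annThick (htt : TensorTriangulated C) {A : C} (a : A ⟶ 𝟙_ C) (B : C) :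
    B ∈ (annThick htt a).set ↔ ∃ n : ℕ, 0 < n ∧ npowMap a n ▷ B = 0 := Iff.rfl

lemma tensor_triangle (htt : TensorTriangulated C) {A P Q R : C} {a : P ⟶ Q} {u : Q ⟶ R}
    {δ : R ⟶ P⟦(1 : ℤ)⟧} (hT : Triangle.mk a u δ ∈ distTriang C) :
    ∃ δ' : A ⊗ R ⟶ (A ⊗ P)⟦(1 : ℤ)⟧, Triangle.mk (A ◁ a) (A ◁ u) δ' ∈ distTriang C := by
  obtain ⟨e, he⟩ := htt A _ hT
  exact ⟨_, he⟩

lemma triangle_iso {P Q Q' R : C} {a : P ⟶ Q} {u : Q ⟶ R} {δ : R ⟶ P⟦(1 : ℤ)⟧}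
    (e : Q ≅ Q') (hT : Triangle.mk a u δ ∈ distTriang C) :
    Triangle.mk (a ≫ e.hom) (e.inv ≫ u) δ ∈ distTriang C := by
  refine isomorphic_distinguished _ hT _
    (Triangle.isoMk _ _ (Iso.refl P) e.symm (Iso.refl R) ?_ ?_ ?_)
  · change (a ≫ e.hom) ≫ e.inv = 𝟙 P ≫ a
    simp
  · change (e.inv ≫ u) ≫ 𝟙 R = e.inv ≫ u
    simp
  · change δ ≫ (𝟙 P)⟦(1 : ℤ)⟧' = 𝟙 R ≫ δ
    simp

lemma approx (htt : TensorTriangulated C) (S : ThickSubcategory C) (hS : IsThickIdeal S)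
    {A R : C} (a : A ⟶ 𝟙_ C) (u : 𝟙_ C ⟶ R) (δ : R ⟶ A⟦(1 : ℤ)⟧)
    (hT : Triangle.mk a u δ ∈ distTriang C) (hR : R ∈ S.set) (n : ℕ) :
    ∃ (P : C) (p : P ⟶ 𝟙_ C) (t : P ⟶ npow A n), p = t ≫ npowMap a n ∧ HasConeIn S p := by
  induction n with
  | zero =>
    refine ⟨𝟙_ C, 𝟙 _, 𝟙 (𝟙_ C), (Category.id_comp _).symm, _, _, _,
      contractible_distinguished _, ?_⟩
    exact S.retract_closed (Y := R) 0 0 ((isZero_zero C).eq_of_src _ _) hR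
  | succ n ih =>
    obtain ⟨P, p, t, hp, hc⟩ := ih
    obtain ⟨δ', he⟩ := tensor_triangle (A := P) htt hT
    have h1 : HasConeIn S (P ◁ a ≫ (ρ_ P).hom) := by
      exact ⟨P ⊗ R, _, _, triangle_iso (ρ_ P) he, hS P hR⟩
    obtain ⟨P', g', s, hg', hc'⟩ := comp_approx S _ _ h1 hc
    refine ⟨P', g', s ≫ (β_ P A).hom ≫ A ◁ t, ?_, hc'⟩
    have : (P ◁ a ≫ (ρ_ P).hom) ≫ p =
        ((β_ P A).hom ≫ A ◁ t) ≫ (a ⊗ₘ npowMap a n) ≫ (λ_ (𝟙_ C)).hom := by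
      have h2 : A ◁ t ≫ (a ⊗ₘ npowMap a n) = a ⊗ₘ p := by
        rw [hp, MonoidalCategory.tensorHom_def', MonoidalCategory.tensorHom_def',
          MonoidalCategory.whiskerLeft_comp, Category.assoc]
      rw [Category.assoc, Category.assoc, reassoc_of% h2,
        ← BraidedCategory.braiding_naturality_assoc, braiding_leftUnitor,
        MonoidalCategory.tensorHom_def', Category.assoc, MonoidalCategory.rightUnitor_naturality]
    rw [hg', this]
    change _ = (s ≫ (β_ P A).hom ≫ A ◁ t) ≫ (a ⊗ₘ npowMap a n) ≫ (λ_ (𝟙_ C)).hom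
    simp only [Category.assoc]

lemma part_one (htt : TensorTriangulated C)
    (hdual : ∀ X Y : C, IsIso (dualPairing X Y))
    (X AX : C) (aX : AX ⟶ 𝟙_ C) (δX : (ihom X).obj X ⟶ AX⟦(1 : ℤ)⟧)
    (hX : Triangle.mk aX (unitMap X) δX ∈ distTriang C) :
    thickIdealGen C {X} = {B : C | ∃ n : ℕ, 0 < n ∧ npowMap aX n ▷ B = 0} := by
  apply Set.Subset.antisymm
  · intro B hB
    refine (mem_annThick htt aX B).1 (hB (annThick htt aX) ?_ ?_)
    · rintro W Z ⟨n, hn, h⟩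
      exact ⟨n, hn, kills_tensor W h⟩
    · rintro _ rfl
      refine ⟨1, one_pos, ?_⟩
      have h0 := kills_unit aX (comp_distTriang_mor_zero₁₂ _ hX)
      change ((aX ⊗ₘ 𝟙 (𝟙_ C)) ≫ (λ_ (𝟙_ C)).hom) ▷ _ = 0
      rw [MonoidalCategory.tensorHom_id, unitors_equal, MonoidalCategory.rightUnitor_naturality,
        comp_whiskerRight, h0, comp_zero]
  · rintro B ⟨n, -, h⟩ S hS hXS
    have hXS' : X ∈ S.set := hXS rfl
    have hR : (ihom X).obj X ∈ S.set :=
      have := hdual X X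
      S.iso_closed (asIso (dualPairing X X)) (hS _ hXS')
    obtain ⟨P, p, t, hp, F, u, δ, hT, hF⟩ := approx htt S hS aX _ _ hX hR n
    obtain ⟨δ', he⟩ := tensor_triangle (A := B) htt hT
    have hz : B ◁ p = 0 := by
      apply left_of_right
      rw [hp, comp_whiskerRight, h, comp_zero]
    obtain ⟨r, hr⟩ := cofactor2 he (𝟙 _) (by rw [hz, zero_comp])
    exact S.iso_closed (ρ_ B) (S.retract_closed _ r hr.symm (hS B hF))

end Stmt5Aux

/-- Let `C` be a closed symmetric tensor triangulated category in which every object is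
dualizable.  For objects `X`, `Y`, choose fibres `aX : AX ⟶ 𝟙_ C` and
`aY : AY ⟶ 𝟙_ C` of the unit maps `𝟙_ C ⟶ F(X,X)` and `𝟙_ C ⟶ F(Y,Y)` (i.e.
`AX = ann X`, `AY = ann Y`).  Then:
(1) the thick ideal generated by `X` is the class of objects `B` such that the map
`ann(X)^{⊗n} ⊗ B ⟶ B` is zero for some `n > 0`; and
(2) `thickid X ⊆ thickid Y` if and only if `ann(Y)^{⊗n} ⟶ 𝟙_ C` factors through
`ann(X) ⟶ 𝟙_ C` for some `n > 0`. -/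
theorem stmt_5 (htt : TensorTriangulated C)
    (hdual : ∀ X Y : C, IsIso (dualPairing X Y))
    (X Y AX AY : C)
    (aX : AX ⟶ 𝟙_ C) (δX : (ihom X).obj X ⟶ AX⟦(1 : ℤ)⟧)
    (hX : Triangle.mk aX (unitMap X) δX ∈ distTriang C)
    (aY : AY ⟶ 𝟙_ C) (δY : (ihom Y).obj Y ⟶ AY⟦(1 : ℤ)⟧)
    (hY : Triangle.mk aY (unitMap Y) δY ∈ distTriang C) :
    (thickIdealGen C {X} =
      {B : C | ∃ n : ℕ, 0 < n ∧ (npowMap aX n ▷ B) ≫ (λ_ B).hom = 0}) ∧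
    (thickIdealGen C {X} ⊆ thickIdealGen C {Y} ↔
      ∃ n : ℕ, 0 < n ∧ ∃ φ : npow AY n ⟶ AX, φ ≫ aX = npowMap aY n) := by
  have h1 := Stmt5Aux.part_one htt hdual X AX aX δX hX
  have h2 := Stmt5Aux.part_one htt hdual Y AY aY δY hY
  refine ⟨?_, ?_⟩
  · rw [h1]
    ext B
    simp only [Set.mem_ofPred_eq]
    refine exists_congr fun n => and_congr_right fun _ => ?_
    constructor
    · intro h
      rw [h, zero_comp]
    · intro h
      rw [← cancel_mono (λ_ B).hom, h, zero_comp]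
  · constructor
    · intro hsub
      have hXY : X ∈ thickIdealGen C {Y} := hsub (fun S _ hS => hS rfl)
      rw [h2] at hXY
      obtain ⟨n, hn, h⟩ := hXY
      refine ⟨n, hn, ?_⟩
      obtain ⟨φ, hφ⟩ := Triangle.coyoneda_exact₂ _ hX (npowMap aY n) (Stmt5Aux.comp_unitMap _ h)
      exact ⟨φ, hφ.symm⟩
    · rintro ⟨n, hn, φ, hφ⟩
      have hXY : X ∈ thickIdealGen C {Y} := by
        rw [h2]
        refine ⟨n, hn, ?_⟩
        rw [← hφ, comp_whiskerRight,
          Stmt5Aux.kills_unit aX (comp_distTriang_mor_zero₁₂ _ hX), comp_zero]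
      intro B hB S hS hYS
      refine hB S hS ?_
      rintro _ rfl
      exact hXY S hS hYS
end

section
/- Let p be a prime, and let S = 𝔽_p[τ, Q]/(Q²) be the quotient of the polynomial ring over the field with p elements in two variables τ and Q by the ideal generated by Q². Let M be an S-module which is free as a module over the subring 𝔽_p[τ] and free as a module over the subring 𝔽_p[Q]/(Q²). Then M is a free S-module. -/
/-!
STATEMENT 9: Let `p` be a prime and `S = 𝔽_p[τ, Q]/(Q²)`.  If an `S`-module `M` is
free over the subring `𝔽_p[τ]` (the image of the polynomial ring in `τ`) and free
over the subring `𝔽_p[Q]/(Q²)` (the image of the polynomial ring in `Q`), then `M`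
is a free `S`-module.
-/

/-- The ring `S = 𝔽_p[τ, Q]/(Q²)`, presented as the quotient of the polynomial ring
in two variables `τ = X 0`, `Q = X 1` over `𝔽_p = ZMod p` by the ideal `(Q²)`. -/
abbrev Sring (p : ℕ) : Type :=
  MvPolynomial (Fin 2) (ZMod p) ⧸
    Ideal.span ({(MvPolynomial.X 1 : MvPolynomial (Fin 2) (ZMod p)) ^ 2} :
      Set (MvPolynomial (Fin 2) (ZMod p)))

/-- The class of `τ` in `S`. -/
noncomputable def tauBar (p : ℕ) : Sring p :=
  Ideal.Quotient.mk _ (MvPolynomial.X 0)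

/-- The class of `Q` in `S`. -/
noncomputable def qBar (p : ℕ) : Sring p :=
  Ideal.Quotient.mk _ (MvPolynomial.X 1)

/-- The subring `𝔽_p[τ]` of `S`, i.e. the image of the polynomial ring in `τ`. -/
noncomputable def tauSubring (p : ℕ) : Subring (Sring p) :=
  (Polynomial.aeval (R := ZMod p) (tauBar p)).toRingHom.range

/-- The subring `𝔽_p[Q]/(Q²)` of `S`, i.e. the image of the polynomial ring in `Q`. -/
noncomputable def qSubring (p : ℕ) : Subring (Sring p) :=
  (Polynomial.aeval (R := ZMod p) (qBar p)).toRingHom.range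

open Module in
theorem free_sub_finsupp {R : Type*} [CommRing R] [IsDomain R] [IsPrincipalIdealRing R]
    {ι : Type*} [LinearOrder ι] [WellFoundedLT ι] (N : Submodule R (ι →₀ R)) :
    Module.Free R N := by
  classical
  let P : ι → Submodule R (ι →₀ R) := fun i => N ⊓ Finsupp.supported R R (Set.Iic i)
  let I : ι → Ideal R := fun i => (P i).map (Finsupp.lapply i)
  let a : ι → R := fun i => Submodule.IsPrincipal.generator (I i)
  have ha : ∀ i, ∃ n ∈ P i, n i = a i := by
    intro i
    have h : a i ∈ I i := Submodule.IsPrincipal.generator_mem (I i)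
    obtain ⟨n, hn, hn'⟩ := (Submodule.mem_map).1 h
    exact ⟨n, hn, hn'⟩
  choose n hnP hna using ha
  have hn0 : ∀ i j, i < j → n i j = 0 := by
    intro i j hij
    by_contra hne
    have h2 := (hnP i).2
    have h3 := (Finsupp.mem_supported R (n i)).1 h2
    have h4 : j ∈ Set.Iic i := h3 (by simpa using hne)
    exact absurd (h4 : j ≤ i) (not_le.2 hij)
  let v : {i // a i ≠ 0} → (ι →₀ R) := fun j => n j
  have hli : LinearIndependent R v := by
    refine linearIndependent_iff.2 ?_
    intro l hl
    by_contra hne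
    have hs : l.support.Nonempty := Finsupp.support_nonempty_iff.2 hne
    let j := l.support.max' hs
    have hj : j ∈ l.support := l.support.max'_mem hs
    have h1 : (Finsupp.linearCombination R v l) (j : ι) = 0 := by
      rw [hl]; rfl
    rw [Finsupp.linearCombination_apply, Finsupp.sum] at h1
    rw [Finsupp.finset_sum_apply, Finset.sum_eq_single_of_mem j hj] at h1
    · have h2 : l j * a j = 0 := by
        rw [← hna]; exact h1
      rcases mul_eq_zero.1 h2 with h | h
      · exact (Finsupp.mem_support_iff.1 hj) h
      · exact j.2 h
    · intro b hb hbj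
      have hlt : b < j := lt_of_le_of_ne (l.support.le_max' b hb) hbj
      have := hn0 b j hlt
      show l b * n b j = 0
      rw [this, mul_zero]
  have hsp : ∀ i, ∀ x ∈ N, x ∈ Finsupp.supported R R (Set.Iic i) →
      x ∈ Submodule.span R (Set.range v) := by
    intro i
    induction i using WellFoundedLT.induction with
    | _ i ih =>
    intro x hxN hx
    have key : ∀ y ∈ N, y ∈ Finsupp.supported R R (Set.Iic i) →
        y i = 0 → y ∈ Submodule.span R (Set.range v) := by
      intro y hyN hy hyi
      by_cases hy0 : y.support.Nonempty
      · have hm := y.support.max'_mem hy0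
        refine ih (y.support.max' hy0) ?_ y hyN ?_
        · refine lt_of_le_of_ne ((Finsupp.mem_supported R _).1 hy hm) ?_
          intro h
          rw [h] at hm
          exact (Finsupp.mem_support_iff.1 hm) hyi
        · rw [Finsupp.mem_supported]
          intro k hk
          exact y.support.le_max' k hk
      · have : y = 0 := by
          simpa [Finset.not_nonempty_iff_eq_empty] using hy0
        rw [this]; exact Submodule.zero_mem _
    have hxI : x i ∈ I i := Submodule.mem_map.2 ⟨x, ⟨hxN, hx⟩, rfl⟩
    obtain ⟨c, hc⟩ := (Submodule.IsPrincipal.mem_iff_eq_smul_generator (I i)).1 hxI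
    by_cases hai : a i = 0
    · apply key x hxN hx
      rw [hc]
      show c • a i = 0
      rw [hai, smul_zero]
    · have hv : n i ∈ Submodule.span R (Set.range v) :=
        Submodule.subset_span ⟨⟨i, hai⟩, rfl⟩
      have h := key (x - c • n i) (Submodule.sub_mem _ hxN (Submodule.smul_mem _ c (hnP i).1))
        (Submodule.sub_mem _ hx (Submodule.smul_mem _ c (hnP i).2)) (by
          rw [Finsupp.sub_apply, Finsupp.smul_apply, hna, hc]; exact sub_self _)
      have := Submodule.add_mem _ h (Submodule.smul_mem _ c hv)
      rwa [sub_add_cancel] at this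
  have hN : Submodule.span R (Set.range v) = N := by
    apply le_antisymm
    · rw [Submodule.span_le]
      rintro _ ⟨j, rfl⟩
      exact (hnP j).1
    · intro x hxN
      by_cases hy0 : x.support.Nonempty
      · refine hsp (x.support.max' hy0) x hxN ?_
        rw [Finsupp.mem_supported]
        intro k hk
        exact x.support.le_max' k hk
      · have : x = 0 := by
          simpa [Finset.not_nonempty_iff_eq_empty] using hy0
        rw [this]; exact Submodule.zero_mem _
  rw [← hN]
  exact Module.Free.of_basis (Basis.span hli)

theorem free_sub_of_pid {R : Type*} [CommRing R] [IsDomain R] [IsPrincipalIdealRing R]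
    {M : Type*} [AddCommGroup M] [Module R M] [Module.Free R M] (N : Submodule R M) :
    Module.Free R N := by
  classical
  let b := Module.Free.chooseBasis R M
  let : LinearOrder (Module.Free.ChooseBasisIndex R M) :=
    IsWellOrder.linearOrder (WellOrderingRel)
  have : WellFoundedLT (Module.Free.ChooseBasisIndex R M) :=
    ⟨(inferInstance : IsWellOrder _ WellOrderingRel).wf⟩
  have := free_sub_finsupp (N.map b.repr.toLinearMap)
  exact Module.Free.of_equiv (b.repr.submoduleMap N).symm

theorem free_of_exact {S : Type*} [CommRing S] (R : Subring S) [IsDomain R]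
    [IsPrincipalIdealRing R] (q : S) (hq : q * q = 0)
    (hS : ∀ s : S, ∃ r t : R, s = r + t * q)
    {M : Type*} [AddCommGroup M] [Module S M] [Module.Free R M]
    (hex : ∀ m : M, q • m = 0 → ∃ m', m = q • m') : Module.Free S M := by
  let f : M →ₗ[R] M := 
    { toFun := fun m => q • m
      map_add' := smul_add q
      map_smul' := fun r m => smul_comm q (r : S) m }
  have := free_sub_of_pid (LinearMap.range f)
  let b := Module.Free.chooseBasis R (LinearMap.range f)
  have hb : ∀ i, ∃ m, q • m = (b i : M) := fun i => (b i).2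
  choose m hm using hb
  have hqq : ∀ x : M, q • q • x = 0 := fun x => by rw [smul_smul, hq, zero_smul]
  have hli : LinearIndependent R (fun i => (b i : M)) :=
    b.linearIndependent.map' (LinearMap.range f).subtype (Submodule.ker_subtype _)
  have hspan : ∀ x : M, q • x ∈ Submodule.span R (Set.range fun i => (b i : M)) := by
    intro x
    have h := b.mem_span (⟨f x, x, rfl⟩ : LinearMap.range f)
    have h2 := Submodule.mem_map_of_mem (f := (LinearMap.range f).subtype) h
    rw [Submodule.map_span, ← Set.range_comp] at h2
    exact h2
  have hindep : LinearIndependent S m := by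
    rw [linearIndependent_iff']
    intro s g hg
    choose r t hrt using fun i => hS (g i)
    have h1 : ∑ i ∈ s, r i • (b i : M) = 0 := by
      have : q • ∑ i ∈ s, g i • m i = 0 := by rw [hg, smul_zero]
      rw [Finset.smul_sum] at this
      rw [← this]
      refine Finset.sum_congr rfl fun i _ => ?_
      rw [← hm, hrt]
      show (r i : S) • q • m i = _
      rw [smul_smul, smul_smul]
      congr 1
      linear_combination (-(t i : S)) * hq
    have hr := linearIndependent_iff'.1 hli s r h1
    have h2 : ∑ i ∈ s, t i • (b i : M) = 0 := by
      rw [← hg]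
      refine Finset.sum_congr rfl fun i hi => ?_
      rw [← hm, hrt, hr i hi]
      show (t i : S) • q • m i = _
      rw [smul_smul]
      congr 1
      simp
    have ht := linearIndependent_iff'.1 hli s t h2
    intro i hi
    rw [hrt, hr i hi, ht i hi]
    simp
  have hsub : ∀ y ∈ Submodule.span R (Set.range fun i => (b i : M)),
      ∃ z ∈ Submodule.span S (Set.range m), y = q • z := by
    intro y hy
    induction hy using Submodule.span_induction with
    | mem x hx =>
      obtain ⟨i, rfl⟩ := hx
      exact ⟨m i, Submodule.subset_span ⟨i, rfl⟩, (hm i).symm⟩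
    | zero => exact ⟨0, Submodule.zero_mem _, (smul_zero _).symm⟩
    | add x y _ _ hx hy =>
      obtain ⟨z, hz, rfl⟩ := hx
      obtain ⟨w, hw, rfl⟩ := hy
      exact ⟨z + w, Submodule.add_mem _ hz hw, (smul_add _ _ _).symm⟩
    | smul r x _ hx =>
      obtain ⟨z, hz, rfl⟩ := hx
      exact ⟨(r : S) • z, Submodule.smul_mem _ _ hz, smul_comm (r : S) q z⟩
  refine Module.Free.of_basis (Module.Basis.mk hindep ?_)
  intro x _
  obtain ⟨z, hz, hxz⟩ := hsub _ (hspan x)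
  obtain ⟨w, hw⟩ := hex (x - z) (by rw [smul_sub, hxz, sub_self])
  obtain ⟨u, hu, hwu⟩ := hsub _ (hspan w)
  have : x = z + q • u := by rw [← hwu, ← hw]; abel
  rw [this]
  exact Submodule.add_mem _ hz (Submodule.smul_mem _ _ hu)

theorem qBar_sq (p : ℕ) : qBar p * qBar p = 0 := by
  rw [qBar, ← map_mul, Ideal.Quotient.eq_zero_iff_mem, ← pow_two]
  exact Ideal.subset_span rfl

theorem qBar_ne (p : ℕ) [Fact p.Prime] : qBar p ≠ 0 := by
  rw [qBar, Ne, Ideal.Quotient.eq_zero_iff_mem, Ideal.mem_span_singleton]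
  intro h
  have h1 := map_dvd (MvPolynomial.aeval (fun _ => Polynomial.X : Fin 2 → Polynomial (ZMod p))) h
  simp only [map_pow, MvPolynomial.aeval_X] at h1
  have h2 := Polynomial.natDegree_le_of_dvd h1 Polynomial.X_ne_zero
  simp at h2

theorem tau_inj (p : ℕ) [Fact p.Prime] :
    Function.Injective (Polynomial.aeval (R := ZMod p) (tauBar p)).toRingHom := by
  let g : MvPolynomial (Fin 2) (ZMod p) →ₐ[ZMod p] Polynomial (ZMod p) :=
    MvPolynomial.aeval ![Polynomial.X, 0]
  have hg : ∀ x ∈ Ideal.span ({(MvPolynomial.X 1 : MvPolynomial (Fin 2) (ZMod p)) ^ 2} :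
      Set (MvPolynomial (Fin 2) (ZMod p))), g x = 0 := by
    intro x hx
    obtain ⟨y, rfl⟩ := Ideal.mem_span_singleton.1 hx
    simp [g]
  let h : Sring p →ₐ[ZMod p] Polynomial (ZMod p) := Ideal.Quotient.liftₐ _ g hg
  have hc : h.comp (Polynomial.aeval (R := ZMod p) (tauBar p)) = AlgHom.id _ _ := by
    apply Polynomial.algHom_ext
    rw [AlgHom.comp_apply, Polynomial.aeval_X]
    show g (MvPolynomial.X 0) = _
    simp [g]
  intro x y hxy
  have := congrArg h hxy
  have e := fun z => DFunLike.congr_fun hc z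
  exact (e x).symm.trans (this.trans (e y))

theorem S_decomp (p : ℕ) (s : Sring p) :
    ∃ r t : tauSubring p, s = r + t * qBar p := by
  obtain ⟨s, rfl⟩ := Ideal.Quotient.mk_surjective s
  induction s using MvPolynomial.induction_on with
  | C a =>
    refine ⟨⟨_, Polynomial.C a, rfl⟩, 0, ?_⟩
    simp
    rfl
  | add x y hx hy =>
    obtain ⟨r, t, h⟩ := hx
    obtain ⟨r', t', h'⟩ := hy
    refine ⟨r + r', t + t', ?_⟩
    rw [map_add, h, h']
    push_cast
    ring
  | mul_X x i hx =>
    obtain ⟨r, t, h⟩ := hx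
    rw [map_mul, h]
    fin_cases i
    · have ht : tauBar p ∈ tauSubring p := ⟨Polynomial.X, by simp⟩
      refine ⟨r * ⟨_, ht⟩, t * ⟨_, ht⟩, ?_⟩
      show _ * tauBar p = _
      push_cast
      ring
    · refine ⟨0, r, ?_⟩
      show _ * qBar p = _
      push_cast
      linear_combination (t : Sring p) * qBar_sq p

theorem q_decomp (p : ℕ) (s : Sring p) (hs : s ∈ qSubring p) :
    ∃ a b : ZMod p, s = algebraMap _ _ a + algebraMap _ _ b * qBar p := by
  obtain ⟨f, rfl⟩ := hs
  induction f using Polynomial.induction_on' with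
  | add x y hx hy =>
    obtain ⟨r, t, h⟩ := hx
    obtain ⟨r', t', h'⟩ := hy
    refine ⟨r + r', t + t', ?_⟩
    rw [map_add, h, h']
    simp only [map_add]
    ring
  | monomial n a =>
    rcases n with _ | _ | n
    · exact ⟨a, 0, by simp⟩
    · exact ⟨0, a, by simp [Polynomial.aeval_monomial]⟩
    · refine ⟨0, 0, ?_⟩
      have : qBar p ^ (n + 1 + 1) = 0 := by
        linear_combination qBar p ^ n * qBar_sq p
      simp [Polynomial.aeval_monomial, this]

theorem q_exact (p : ℕ) [Fact p.Prime] (M : Type*) [AddCommGroup M] [Module (Sring p) M]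
    [Module.Free (qSubring p) M] (m : M) (hm : qBar p • m = 0) : ∃ m', m = qBar p • m' := by
  have hq : qBar p ∈ qSubring p := ⟨Polynomial.X, by simp⟩
  let q : qSubring p := ⟨_, hq⟩
  let b := Module.Free.chooseBasis (qSubring p) M
  have h1 : q • b.repr m = 0 := by
    rw [← map_smul]
    have : q • m = 0 := hm
    rw [this, map_zero]
  have h2 : ∀ i, ∃ d : qSubring p, b.repr m i = q * d := by
    intro i
    have h3 : (q : Sring p) * (b.repr m i : Sring p) = 0 := by
      have := DFunLike.congr_fun h1 i
      exact congrArg Subtype.val this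
    obtain ⟨x, y, hxy⟩ := q_decomp p _ (b.repr m i).2
    have h4 : algebraMap (ZMod p) (Sring p) x * qBar p = 0 := by
      rw [hxy] at h3
      change qBar p * _ = 0 at h3
      linear_combination h3 - algebraMap (ZMod p) (Sring p) y * qBar_sq p
    have hx : x = 0 := by
      by_contra hx
      apply qBar_ne p
      have h5 : algebraMap (ZMod p) (Sring p) x⁻¹ * algebraMap (ZMod p) (Sring p) x = 1 := by
        rw [← map_mul, inv_mul_cancel₀ hx, map_one]
      linear_combination algebraMap (ZMod p) (Sring p) x⁻¹ * h4 - qBar p * h5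
    refine ⟨⟨algebraMap _ _ y, Polynomial.C y, by simp⟩, ?_⟩
    apply Subtype.ext
    rw [hxy, hx, map_zero, zero_add, mul_comm]
    rfl
  choose d hd using h2
  refine ⟨∑ i ∈ (b.repr m).support, d i • b i, ?_⟩
  conv_lhs => rw [← b.linearCombination_repr m, Finsupp.linearCombination_apply, Finsupp.sum]
  rw [Finset.smul_sum]
  refine Finset.sum_congr rfl fun i _ => ?_
  rw [hd, mul_smul]
  rfl

/-- Let `p` be a prime and `S = 𝔽_p[τ, Q]/(Q²)`.  Let `M` be an `S`-module which is
free as a module over the subring `𝔽_p[τ]` and free as a module over the subring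
`𝔽_p[Q]/(Q²)` (both via restriction of scalars along the inclusions).  Then `M` is a
free `S`-module. -/
theorem stmt_9 (p : ℕ) (hp : p.Prime)
    (M : Type*) [AddCommGroup M] [Module (Sring p) M]
    (hτ : @Module.Free (tauSubring p) M _ _
      (Module.compHom M ((tauSubring p).subtype)))
    (hQ : @Module.Free (qSubring p) M _ _
      (Module.compHom M ((qSubring p).subtype))) :
    Module.Free (Sring p) M := by
  have : Fact p.Prime := ⟨hp⟩
  let e : Polynomial (ZMod p) ≃+* tauSubring p :=
    RingEquiv.ofBijective (Polynomial.aeval (R := ZMod p) (tauBar p)).toRingHom.rangeRestrict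
      ⟨fun x y h => tau_inj p (congrArg Subtype.val h), RingHom.rangeRestrict_surjective _⟩
  have : IsDomain (tauSubring p) := e.symm.toMulEquiv.isDomain _
  have : IsPrincipalIdealRing (tauSubring p) :=
    IsPrincipalIdealRing.of_surjective e.toRingHom e.surjective
  have : Module.Free (tauSubring p) M := hτ
  have : Module.Free (qSubring p) M := hQ
  exact free_of_exact (tauSubring p) (qBar p) (qBar_sq p) (S_decomp p) (q_exact p M)
end
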